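/- Let G be a 4-connected finite simple graph containing edges xy and x'y' whose four endpoints x, y, x', y' are pairwise distinct, such that at least three of the four pairs xx', xy', x'y, yy' are edges of G (i.e., the crossing of xy and x'y' is full or almost full). Let G' be the graph obtained from G by deleting the edges xy and x'y' and adding a new vertex v adjacent exactly to x, y, x', y'. Then G' is 3-connected and every 3-cut of G' contains the new vertex v. -/

import Mathlib

open SimpleGraph

/-- The graph obtained from `G` by deleting the edges `xy` and `x'y'` and adding a new
vertex (`none`) adjacent exactly to `x`, `y`, `x'`, `y'`. -/
def addCrossingVertex {V : Type*} (G : SimpleGraph V) (x y x' y' : V) :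
    SimpleGraph (Option V) :=
  SimpleGraph.map Function.Embedding.some (G.deleteEdges {s(x, y), s(x', y')}) ⊔
    SimpleGraph.fromEdgeSet {s((none : Option V), some x), s(none, some y),
      s(none, some x'), s(none, some y')}

/-- A graph is `k`-connected if it has more than `k` vertices and deleting any set of fewer
than `k` vertices leaves a connected graph. -/
def KConnected {V : Type*} [Fintype V] (k : ℕ) (G : SimpleGraph V) : Prop :=
  k < Fintype.card V ∧
    ∀ S : Finset V, S.card < k → (G.induce ((↑S : Set V)ᶜ)).Connected

/-- A graph minus a vertex set `S` is connected iff some vertex is left and any equivalence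
relation containing the adjacencies outside `S` relates all vertices outside `S`. -/
theorem connected_induce_compl_iff {V : Type*} (G : SimpleGraph V) (S : Set V) :
    (G.induce Sᶜ).Connected ↔ Sᶜ.Nonempty ∧ ∀ R : V → V → Prop, Equivalence R →
      (∀ a b, a ∉ S → b ∉ S → G.Adj a b → R a b) → ∀ a b, a ∉ S → b ∉ S → R a b := by
  constructor
  · intro h
    refine ⟨Set.nonempty_coe_sort.1 h.nonempty, fun R hR hadj a b ha hb ↦ ?_⟩
    obtain ⟨p⟩ := h.preconnected ⟨a, ha⟩ ⟨b, hb⟩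
    suffices ∀ u w : ↥(Sᶜ), (G.induce Sᶜ).Walk u w → R u w from this _ _ p
    intro u w q
    induction q with
    | nil => exact hR.refl _
    | @cons u w _ huw _ ih => exact hR.trans (hadj _ _ u.2 w.2 huw) ih
  · rintro ⟨hne, h⟩
    have : Nonempty ↥(Sᶜ) := hne.to_subtype
    refine ⟨fun u w ↦ ?_⟩
    have key := h (fun a b ↦ a = b ∨ ∃ (ha : a ∈ Sᶜ) (hb : b ∈ Sᶜ),
        (G.induce Sᶜ).Reachable ⟨a, ha⟩ ⟨b, hb⟩) ?_ ?_ u w u.2 w.2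
    · rcases key with heq | ⟨_, _, hr⟩
      · rw [Subtype.ext heq]
      · exact hr
    · refine ⟨fun _ ↦ Or.inl rfl, ?_, ?_⟩
      · rintro a b (rfl | ⟨ha, hb, hr⟩)
        · exact Or.inl rfl
        · exact Or.inr ⟨hb, ha, hr.symm⟩
      · rintro a b c (rfl | ⟨ha, hb, hr⟩) (rfl | ⟨hb', hc, hr'⟩)
        · exact Or.inl rfl
        · exact Or.inr ⟨hb', hc, hr'⟩
        · exact Or.inr ⟨ha, hb, hr⟩
        · exact Or.inr ⟨ha, hc, hr.trans hr'⟩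
    · intro a b ha hb hab
      exact Or.inr ⟨ha, hb, SimpleGraph.Adj.reachable (G := G.induce Sᶜ) hab⟩

theorem KConnected.rel {V : Type*} [Fintype V] {k : ℕ} {G : SimpleGraph V}
    (hG : KConnected k G) {U : Finset V} (hU : U.card < k) {R : V → V → Prop}
    (hR : Equivalence R) (hadj : ∀ a b, a ∉ U → b ∉ U → G.Adj a b → R a b) {a b : V}
    (ha : a ∉ U) (hb : b ∉ U) : R a b :=
  ((connected_induce_compl_iff G (U : Set V)).1 (hG.2 U hU)).2 R hR
    (by simpa using hadj) a b (by simpa using ha) (by simpa using hb)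

/-- In a 4-connected graph, after deleting at most one vertex, the ends of an edge `ab` are still
linked by edges other than `ab` and those at a further vertex `z`. -/
theorem KConnected.rel_of_edge_deleted {V : Type*} [Fintype V] [DecidableEq V]
    {G : SimpleGraph V} (hG : KConnected 4 G) {T : Finset V} (hT : T.card ≤ 1)
    {R : V → V → Prop} (hR : Equivalence R) {a b z : V} (haz : a ≠ z) (hbz : b ≠ z)
    (hab : a ≠ b) (ha : a ∉ T) (hb : b ∉ T)
    (hadj : ∀ u w, u ∉ T → w ∉ T → u ≠ z → w ≠ z → s(u, w) ≠ s(a, b) → G.Adj u w → R u w) :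
    R a b := by
  have card_le (c d : V) : (insert c (insert d T)).card ≤ T.card + 2 :=
    (Finset.card_insert_le _ _).trans (by grind [Finset.card_insert_le d T])
  obtain ⟨w, hw⟩ : ∃ w, w ∉ insert a (insert b (insert z T)) := by
    by_contra! h
    have h1 := Finset.card_le_card (fun w _ ↦ h w : Finset.univ ⊆ insert a (insert b (insert z T)))
    have h2 := Finset.card_insert_le a (insert b (insert z T))
    have h3 := card_le b z
    have h4 := hG.1
    rw [Finset.card_univ] at h1
    omega
  simp only [Finset.mem_insert, not_or] at hw
  obtain ⟨hwa, hwb, hwz, hwT⟩ := hw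
  have haw : R a w := by
    refine hG.rel (U := insert b (insert z T)) (by grind) hR ?_ (by grind) (by grind)
    intro u v hu hv huv
    exact hadj u v (by grind) (by grind) (by grind) (by grind) (by grind [Sym2.eq_iff]) huv
  have hbw : R b w := by
    refine hG.rel (U := insert a (insert z T)) (by grind) hR ?_ (by grind) (by grind)
    intro u v hu hv huv
    exact hadj u v (by grind) (by grind) (by grind) (by grind) (by grind [Sym2.eq_iff]) huv
  exact hR.trans haw (hR.symm hbw)

theorem addCrossingVertex_adj_some {V : Type*} (G : SimpleGraph V) {x y x' y' a b : V}
    (hab : G.Adj a b) (h : s(a, b) ≠ s(x, y)) (h' : s(a, b) ≠ s(x', y')) :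
    (addCrossingVertex G x y x' y').Adj (some a) (some b) :=
  Or.inl ((SimpleGraph.map_adj _ _ _ _).2 ⟨a, b, by simp_all, rfl, rfl⟩)

theorem addCrossingVertex_adj_none {V : Type*} (G : SimpleGraph V) {x y x' y' a : V}
    (ha : a = x ∨ a = y ∨ a = x' ∨ a = y') :
    (addCrossingVertex G x y x' y').Adj none (some a) := by
  refine Or.inr ?_
  rcases ha with rfl | rfl | rfl | rfl <;> simp

theorem addCrossingVertex_induce_compl_connected {V : Type*} [Fintype V] [DecidableEq V]
    {G : SimpleGraph V} {x y x' y' : V} (hxy : x ≠ y) (hxx' : x ≠ x') (hxy' : x ≠ y')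
    (hyx' : y ≠ x') (hyy' : y ≠ y') (hx'y' : x' ≠ y') (hG : KConnected 4 G)
    {S : Finset (Option V)} (hS : S.card ≤ 3) (hSnone : none ∈ S → S.card ≤ 2) :
    ((addCrossingVertex G x y x' y').induce ((↑S : Set (Option V))ᶜ)).Connected := by
  have hV := hG.1
  rw [connected_induce_compl_iff]
  constructor
  · obtain ⟨w, -, hw⟩ := Finset.exists_mem_notMem_of_card_lt_card (s := S) (t := Finset.univ)
      (by rw [Finset.card_univ, Fintype.card_option]; omega)
    exact ⟨w, by simpa using hw⟩
  intro R hR hadj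
  simp only [Finset.mem_coe] at hadj ⊢
  set T : Finset V := S.eraseNone with hTdef
  have memT (a : V) : a ∈ T ↔ some a ∈ S := Finset.mem_eraseNone
  have hR' : Equivalence fun a b : V ↦ R (some a) (some b) :=
    ⟨fun _ ↦ hR.refl _, fun h ↦ hR.symm h, fun h h' ↦ hR.trans h h'⟩
  have hold (a b : V) (ha : a ∉ T) (hb : b ∉ T) (hab : G.Adj a b) (h : s(a, b) ≠ s(x, y))
      (h' : s(a, b) ≠ s(x', y')) : R (some a) (some b) :=
    hadj _ _ (by rwa [← memT]) (by rwa [← memT]) (addCrossingVertex_adj_some G hab h h')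
  have hlink (hTc : T.card ≤ 3) (h : x ∉ T → y ∉ T → R (some x) (some y))
      (h' : x' ∉ T → y' ∉ T → R (some x') (some y')) (a b : V) (ha : a ∉ T) (hb : b ∉ T) :
      R (some a) (some b) := by
    refine hG.rel (U := T) (by omega) hR' ?_ ha hb
    intro u w hu hw huw
    by_cases h1 : s(u, w) = s(x, y)
    · rcases Sym2.eq_iff.1 h1 with ⟨rfl, rfl⟩ | ⟨rfl, rfl⟩
      exacts [h hu hw, hR.symm (h hw hu)]
    by_cases h2 : s(u, w) = s(x', y')
    · rcases Sym2.eq_iff.1 h2 with ⟨rfl, rfl⟩ | ⟨rfl, rfl⟩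
      exacts [h' hu hw, hR.symm (h' hw hu)]
    exact hold u w hu hw huw h1 h2
  by_cases hn : none ∈ S
  · have hTc : T.card ≤ 1 := by
      have : T.card = S.card - 1 := Finset.card_eraseNone_of_mem hn
      have := hSnone hn
      omega
    have hsome := hlink (by omega)
      (fun hx hy ↦ hG.rel_of_edge_deleted hTc hR' hxx' hyx' hxy hx hy
        fun u w hu hw hux hwx h huw ↦ hold u w hu hw huw h (by grind [Sym2.eq_iff]))
      (fun hx hy ↦ hG.rel_of_edge_deleted hTc hR' hxx'.symm hxy'.symm hx'y' hx hy
        fun u w hu hw hux hwx h huw ↦ hold u w hu hw huw (by grind [Sym2.eq_iff]) h)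
    rintro (_ | a) (_ | b) ha hb
    exacts [hR.refl _, absurd hn ha, absurd hn hb, hsome a b (by rwa [memT]) (by rwa [memT])]
  · have hTc : T.card ≤ 3 := by
      rwa [hTdef, Finset.card_eraseNone_of_not_mem hn]
    have hnone (a : V) (ha : a ∉ T) (h : a = x ∨ a = y ∨ a = x' ∨ a = y') : R none (some a) :=
      hadj _ _ hn (by rwa [← memT]) (addCrossingVertex_adj_none G h)
    have hsome := hlink hTc
      (fun hx hy ↦ hR.trans (hR.symm (hnone x hx (by simp))) (hnone y hy (by simp)))
      (fun hx hy ↦ hR.trans (hR.symm (hnone x' hx (by simp))) (hnone y' hy (by simp)))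
    obtain ⟨c, hc, hcT⟩ := Finset.exists_mem_notMem_of_card_lt_card (s := T)
      (t := {x, y, x', y'}) (by
        have : ({x, y, x', y'} : Finset V).card = 4 := by simp [*]
        omega)
    have hnc := hnone c hcT (by simpa using hc)
    have hall (b : V) (hb : some b ∉ S) : R none (some b) :=
      hR.trans hnc (hsome c b hcT (by rwa [memT]))
    rintro (_ | a) (_ | b) ha hb
    exacts [hR.refl _, hall b hb, hR.symm (hall a ha),
      hsome a b (by rwa [memT]) (by rwa [memT])]

/-- If `G` is 4-connected and the crossing of `xy` and `x'y'` is full or almost full, then the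
graph obtained by turning the crossing into a new 4-valent vertex `v = none` is 3-connected and
every 3-cut of it contains `v`. -/
theorem crossing_vertex_of_four_connected {V : Type*} [Fintype V] [DecidableEq V]
    (G : SimpleGraph V) (x y x' y' : V)
    (hxy : x ≠ y) (hxx' : x ≠ x') (hxy' : x ≠ y') (hyx' : y ≠ x') (hyy' : y ≠ y')
    (hx'y' : x' ≠ y')
    (e1 : G.Adj x y) (e2 : G.Adj x' y')
    (hfull : (G.Adj x y' ∧ G.Adj x' y ∧ G.Adj y y') ∨
      (G.Adj x x' ∧ G.Adj x' y ∧ G.Adj y y') ∨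
      (G.Adj x x' ∧ G.Adj x y' ∧ G.Adj y y') ∨
      (G.Adj x x' ∧ G.Adj x y' ∧ G.Adj x' y))
    (h4conn : KConnected 4 G) :
    KConnected 3 (addCrossingVertex G x y x' y') ∧
      ∀ S : Finset (Option V), S.card = 3 →
        ¬((addCrossingVertex G x y x' y').induce ((↑S : Set (Option V))ᶜ)).Connected →
        none ∈ S := by
  constructor
  · refine ⟨?_, fun S hS ↦ addCrossingVertex_induce_compl_connected hxy hxx' hxy' hyx' hyy' hx'y'
      h4conn (by omega) (by omega)⟩
    have := h4conn.1
    rw [Fintype.card_option]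
    omega
  · intro S hS hcut
    by_contra hn
    exact hcut (addCrossingVertex_induce_compl_connected hxy hxx' hxy' hyx' hyy' hx'y' h4conn
      hS.le (fun h ↦ absurd h hn))
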